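/- The second overflow constant satisfies c_over^{(2)} = −1 − c_BM, i.e. inf_{t ∈ 𝒯_2} sInf σ(B^{(2)}_t) = −1 − sSup σ(B_{⟨0,1⟩}). -/

import Mathlib

open MeasureTheory Filter

noncomputable section

namespace QB

/-- Lebesgue measure on the positive half-line. -/
abbrev μp : Measure ℝ := volume.restrict (Set.Ioi (0:ℝ))

/-- The Hilbert space `L²((0,∞))`. -/
abbrev Hp : Type := Lp ℂ 2 μp

/-- The Hilbert space `L²(ℝ)`. -/
abbrev HL : Type := Lp ℂ 2 (volume : Measure ℝ)

/-- The defining properties of the operators: `S t` is multiplication by `e^{-i k² t}`,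
`R` is the isometry "extend by zero and apply the inverse Fourier–Plancherel transform"
(characterised by its isometry property together with the integral formula on
integrable elements of `L²((0,∞))`, which determine it uniquely by continuity and density),
and `Pm` is the orthogonal projection onto functions supported in `(-∞,0)`. -/
structure Setup (S : ℝ → Hp →L[ℂ] Hp) (R : Hp →L[ℂ] HL) (Pm : HL →L[ℂ] HL) : Prop where
  hS : ∀ (t : ℝ) (φ : Hp),
    (S t φ : ℝ → ℂ) =ᵐ[μp] fun k => Complex.exp (-Complex.I * (k:ℂ)^2 * (t:ℂ)) * φ k
  hR_isometry : ∀ φ : Hp, ‖R φ‖ = ‖φ‖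
  hR : ∀ φ : Hp, Integrable (φ : ℝ → ℂ) μp →
    (R φ : ℝ → ℂ) =ᵐ[volume]
      fun x => (((2 * Real.pi) ^ (-(1/2) : ℝ) : ℝ) : ℂ) *
        ∫ k in Set.Ioi (0:ℝ), Complex.exp (Complex.I * (x:ℂ) * (k:ℂ)) * φ k
  hPm : ∀ ψ : HL, (Pm ψ : ℝ → ℂ) =ᵐ[volume] Set.indicator (Set.Iio (0:ℝ)) (fun x => ψ x)

/-- The single backflow operator `B_{⟨t₁,t₂⟩} = S_{t₂}* R* Π⁻ R S_{t₂} − S_{t₁}* R* Π⁻ R S_{t₁}`. -/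
def B1 (S : ℝ → Hp →L[ℂ] Hp) (R : Hp →L[ℂ] HL) (Pm : HL →L[ℂ] HL) (t₁ t₂ : ℝ) :
    Hp →L[ℂ] Hp :=
  (ContinuousLinearMap.adjoint (S t₂)).comp ((ContinuousLinearMap.adjoint R).comp
    (Pm.comp (R.comp (S t₂))))
  - (ContinuousLinearMap.adjoint (S t₁)).comp ((ContinuousLinearMap.adjoint R).comp
    (Pm.comp (R.comp (S t₁))))

/-- The `M`-fold backflow operator `B^{(M)}_t = Σ_{j=1}^M B_{⟨t_{2j-1}, t_{2j}⟩}`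
(zero-based indexing of the tuple `t`). -/
def BM (S : ℝ → Hp →L[ℂ] Hp) (R : Hp →L[ℂ] HL) (Pm : HL →L[ℂ] HL) (M : ℕ)
    (t : Fin (2*M) → ℝ) : Hp →L[ℂ] Hp :=
  ∑ j : Fin M, B1 S R Pm (t ⟨2*j.1, by have := j.isLt; omega⟩)
    (t ⟨2*j.1+1, by have := j.isLt; omega⟩)

/-- `𝒯_M`: the set of strictly increasing `2M`-tuples of reals. -/
def TM (M : ℕ) : Set (Fin (2*M) → ℝ) := {t | StrictMono t}

/-- The Bracken–Melloy constant `c_BM = sSup σ(B_{⟨0,1⟩})`. -/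
def cBM (S : ℝ → Hp →L[ℂ] Hp) (R : Hp →L[ℂ] HL) (Pm : HL →L[ℂ] HL) : ℝ :=
  sSup (spectrum ℝ (B1 S R Pm 0 1))

/-- The second overflow constant `c_over^{(2)} = inf_{t ∈ 𝒯_2} sInf σ(B^{(2)}_t)`. -/
def cover2 (S : ℝ → Hp →L[ℂ] Hp) (R : Hp →L[ℂ] HL) (Pm : HL →L[ℂ] HL) : ℝ :=
  sInf ((fun t => sInf (spectrum ℝ (BM S R Pm 2 t))) '' TM 2)

section

variable {H : Type*} [NormedAddCommGroup H] [InnerProductSpace ℂ H]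

lemma isPositive_iff_re_inner_nonneg [CompleteSpace H] {T : H →L[ℂ] H} :
    T.IsPositive ↔ IsSelfAdjoint T ∧ ∀ x, 0 ≤ (inner ℂ (T x) x).re :=
  ContinuousLinearMap.isPositive_def'

lemma re_inner_algebraMap_apply (c : ℝ) (x : H) :
    (inner ℂ (algebraMap ℝ (H →L[ℂ] H) c x) x).re = c * ‖x‖ ^ 2 := by
  rw [Algebra.algebraMap_eq_smul_one]
  simp [inner_self_eq_norm_sq_to_K, ← Complex.ofReal_pow]

lemma sSup_spectrum_le_iff [CompleteSpace H] [Nontrivial H] {T : H →L[ℂ] H}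
    (hT : IsSelfAdjoint T) (c : ℝ) :
    sSup (spectrum ℝ T) ≤ c ↔ ∀ x, (inner ℂ (T x) x).re ≤ c * ‖x‖ ^ 2 := by
  have hs : IsSelfAdjoint (algebraMap ℝ (H →L[ℂ] H) c - T) :=
    (IsSelfAdjoint.algebraMap _ (.all c)).sub hT
  rw [csSup_le_iff (spectrum.isCompact T).bddAbove
    (ContinuousFunctionalCalculus.spectrum_nonempty T hT),
    ← le_algebraMap_iff_spectrum_le hT, ContinuousLinearMap.le_def,
    isPositive_iff_re_inner_nonneg]
  simp only [sub_apply, inner_sub_left, Complex.sub_re,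
    re_inner_algebraMap_apply, sub_nonneg, hs, true_and]

lemma le_sInf_spectrum_iff [CompleteSpace H] [Nontrivial H] {T : H →L[ℂ] H}
    (hT : IsSelfAdjoint T) (c : ℝ) :
    c ≤ sInf (spectrum ℝ T) ↔ ∀ x, c * ‖x‖ ^ 2 ≤ (inner ℂ (T x) x).re := by
  have hs : IsSelfAdjoint (T - algebraMap ℝ (H →L[ℂ] H) c) :=
    hT.sub (IsSelfAdjoint.algebraMap _ (.all c))
  rw [le_csInf_iff (spectrum.isCompact T).bddBelow
    (ContinuousFunctionalCalculus.spectrum_nonempty T hT),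
    ← algebraMap_le_iff_le_spectrum hT, ContinuousLinearMap.le_def,
    isPositive_iff_re_inner_nonneg]
  simp only [sub_apply, inner_sub_left, Complex.sub_re,
    re_inner_algebraMap_apply, sub_nonneg, hs, true_and]

end

lemma norm_sq_eq_integral {α : Type*} [MeasurableSpace α] {μ : Measure α} (ψ : Lp ℂ 2 μ) :
    ‖ψ‖ ^ 2 = ∫ x, ‖ψ x‖ ^ 2 ∂μ := by
  have h := L2.inner_def (𝕜 := ℂ) ψ ψ
  simp only [inner_self_eq_norm_sq_to_K, Complex.coe_algebraMap, ← Complex.ofReal_pow] at h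
  rw [integral_complex_ofReal] at h
  exact_mod_cast h

/-- The unnormalised wave function at time `t` and position `x` with momentum amplitude `f`. -/
def waveInt (f : ℝ → ℂ) (t x : ℝ) : ℂ :=
  ∫ k in Set.Ioi (0 : ℝ), Complex.exp (Complex.I * (x : ℂ) * (k : ℂ)) *
    (Complex.exp (-Complex.I * (k : ℂ) ^ 2 * (t : ℂ)) * f k)

lemma waveInt_dilate (f : ℝ → ℂ) {l : ℝ} (hl : 0 < l) (t x : ℝ) :
    waveInt (fun k => (√l : ℂ) * f (l * k)) t x =
      (√l : ℂ) * (l : ℂ)⁻¹ * waveInt f (t / l ^ 2) (x / l) := by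
  have hl' : (l : ℂ) ≠ 0 := by exact_mod_cast hl.ne'
  have h := integral_comp_mul_left_Ioi (fun k : ℝ =>
    Complex.exp (Complex.I * ((x / l : ℝ) : ℂ) * (k : ℂ)) *
    (Complex.exp (-Complex.I * (k : ℂ) ^ 2 * ((t / l ^ 2 : ℝ) : ℂ)) * f k)) 0 hl
  rw [mul_zero, Complex.real_smul, Complex.ofReal_inv] at h
  rw [waveInt, waveInt, mul_assoc, ← h, ← integral_const_mul]
  refine integral_congr_ae (.of_forall fun k => ?_)
  have e1 : Complex.I * ((x / l : ℝ) : ℂ) * ((l * k : ℝ) : ℂ) = Complex.I * x * k := by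
    push_cast; field_simp
  have e2 : -Complex.I * ((l * k : ℝ) : ℂ) ^ 2 * ((t / l ^ 2 : ℝ) : ℂ) =
      -Complex.I * (k : ℂ) ^ 2 * t := by
    push_cast; field_simp
  simp only [e1, e2]
  ring

lemma exists_subset_Ioo_of_isCompact {K : Set ℝ} (hK : IsCompact K) (h0 : K ⊆ Set.Ioi 0) :
    ∃ a b : ℝ, 0 < a ∧ a < b ∧ K ⊆ Set.Ioo a b := by
  have hc : IsCompact (insert 1 K) := hK.insert 1
  obtain ⟨m, hm, hmin⟩ := hc.exists_isLeast (Set.insert_nonempty _ _)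
  obtain ⟨M, hM, hmax⟩ := hc.exists_isGreatest (Set.insert_nonempty _ _)
  have hm0 : 0 < m := (Set.insert_subset (by simp) h0 : insert 1 K ⊆ Set.Ioi 0) hm
  have := hmin hM
  refine ⟨m / 2, M + 1, by positivity, by linarith, fun k hk => ?_⟩
  have h1 := hmin (Set.mem_insert_of_mem _ hk)
  have h2 := hmax (Set.mem_insert_of_mem _ hk)
  constructor <;> linarith

lemma norm_waveInt_le {g : ℝ → ℝ} (hg : ContDiff ℝ 1 g) (hc : HasCompactSupport g)
    (h0 : tsupport g ⊆ Set.Ioi 0) :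
    ∃ a C : ℝ, 0 < a ∧ 0 ≤ C ∧ ∀ x t : ℝ, x * t ≤ 0 → t ≠ 0 →
      ‖waveInt (fun k => (g k : ℂ)) t x‖ ≤ C / (|x| + 2 * a * |t|) := by
  obtain ⟨a, b, ha, hab, hsub⟩ := exists_subset_Ioo_of_isCompact hc h0
  obtain ⟨C₀, hC₀⟩ := hc.exists_bound_of_continuous hg.continuous
  obtain ⟨C₁, hC₁⟩ := hc.deriv.exists_bound_of_continuous (hg.continuous_deriv le_rfl)
  have hC₀' : 0 ≤ C₀ := (norm_nonneg _).trans (hC₀ 0)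
  have hC₁' : 0 ≤ C₁ := (norm_nonneg _).trans (hC₁ 0)
  have hz : ∀ k, k ∉ Set.Ioo a b → g k = 0 := fun k hk =>
    image_eq_zero_of_notMem_tsupport fun h => hk (hsub h)
  refine ⟨a, (C₁ + C₀ / a) * (b - a), ha, by
    have := sub_pos.2 hab; positivity, fun x t hxt ht => ?_⟩
  set m := |x| + 2 * a * |t| with hm
  have ht' : 0 < |t| := abs_pos.2 ht
  have hm0 : 0 < m := by positivity
  have hphase : ∀ k, a ≤ k → m ≤ |x - 2 * k * t| := by
    intro k hk
    rcases lt_or_gt_of_ne ht with h | h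
    · have hx : 0 ≤ x := by nlinarith
      rw [hm, abs_of_nonneg hx, abs_of_neg h]
      refine le_trans ?_ (le_abs_self _)
      nlinarith
    · have hx : x ≤ 0 := by nlinarith
      rw [hm, abs_of_nonpos hx, abs_of_pos h]
      refine le_trans ?_ (neg_le_abs _)
      nlinarith
  have hne : ∀ k, a ≤ k → ((x : ℂ) - 2 * k * t) ≠ 0 := by
    intro k hk h
    have h1 := hphase k hk
    have h2 : x - 2 * k * t = 0 := by exact_mod_cast h
    rw [h2, abs_zero] at h1
    linarith
  set u : ℝ → ℂ := fun k => g k / (Complex.I * ((x : ℂ) - 2 * k * t))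
  set u' : ℝ → ℂ := fun k => (((deriv g k : ℝ) : ℂ) * (Complex.I * ((x : ℂ) - 2 * k * t)) -
    g k * (Complex.I * (-(2 * t)))) / (Complex.I * ((x : ℂ) - 2 * k * t)) ^ 2
  set v : ℝ → ℂ := fun k =>
    Complex.exp (Complex.I * (x : ℂ) * (k : ℂ) + -Complex.I * (k : ℂ) ^ 2 * (t : ℂ))
  set v' : ℝ → ℂ := fun k => v k * (Complex.I * ((x : ℂ) - 2 * k * t))
  have huIcc : Set.uIcc a b = Set.Icc a b := Set.uIcc_of_le hab.le
  have hu : ∀ k ∈ Set.uIcc a b, HasDerivAt u (u' k) k := by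
    intro k hk
    rw [huIcc] at hk
    have h1 : HasDerivAt (fun k : ℝ => (g k : ℂ)) ((deriv g k : ℝ) : ℂ) k :=
      ((hg.differentiable one_ne_zero) k).hasDerivAt.ofReal_comp
    have h2 : HasDerivAt (fun k : ℝ => Complex.I * ((x : ℂ) - 2 * k * t))
        (Complex.I * (-(2 * t))) k := by
      have := (((hasDerivAt_id k).ofReal_comp.const_mul (2 : ℂ)).mul_const (t : ℂ)).const_sub (x : ℂ)
      simpa using this.const_mul Complex.I
    exact h1.div h2 (mul_ne_zero Complex.I_ne_zero (hne k hk.1))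
  have hv : ∀ k ∈ Set.uIcc a b, HasDerivAt v (v' k) k := by
    intro k _
    have h1 := ((hasDerivAt_id k).ofReal_comp.const_mul (Complex.I * (x : ℂ))).add
      ((((hasDerivAt_id k).ofReal_comp.pow 2).const_mul (-Complex.I)).mul_const (t : ℂ))
    refine (h1.cexp).congr_deriv ?_
    simp [v', v]
    ring
  have hu'c : ContinuousOn u' (Set.uIcc a b) := by
    rw [huIcc]
    have := hg.continuous_deriv le_rfl
    have := hg.continuous
    refine ContinuousOn.div (by fun_prop) (by fun_prop) fun k hk => ?_
    exact pow_ne_zero _ (mul_ne_zero Complex.I_ne_zero (hne k hk.1))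
  have hv'c : Continuous v' := by fun_prop
  have hparts := intervalIntegral.integral_mul_deriv_eq_deriv_mul hu hv
    hu'c.intervalIntegrable (hv'c.intervalIntegrable _ _)
  have hw : waveInt (fun k => (g k : ℂ)) t x = ∫ k in a..b, u k * v' k := by
    rw [waveInt, intervalIntegral.integral_of_le hab.le]
    rw [setIntegral_eq_of_subset_of_forall_sdiff_eq_zero measurableSet_Ioi
      (s := Set.Ioc a b) (fun k hk => ha.trans hk.1)]
    · refine setIntegral_congr_fun measurableSet_Ioc fun k hk => ?_
      have := hne k hk.1.le
      simp only [u, v', v, Complex.exp_add]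
      rw [div_mul_eq_mul_div, eq_div_iff (mul_ne_zero Complex.I_ne_zero this)]
      ring
    · intro k hk
      rw [hz k fun h => hk.2 ⟨h.1, h.2.le⟩]
      simp
  have hvn : ∀ k, ‖v k‖ = 1 := by
    intro k
    have : Complex.I * (x : ℂ) * (k : ℂ) + -Complex.I * (k : ℂ) ^ 2 * (t : ℂ) =
        ((x * k - k ^ 2 * t : ℝ) : ℂ) * Complex.I := by push_cast; ring
    simp only [v, this, Complex.norm_exp_ofReal_mul_I]
  have hua : u a = 0 := by simp [u, hz a (by simp)]
  have hub : u b = 0 := by simp [u, hz b (by simp)]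
  rw [hw, hparts, hua, hub]
  simp only [zero_mul, sub_zero, zero_sub, norm_neg]
  have hbound : ∀ k ∈ Set.uIoc a b, ‖u' k * v k‖ ≤ (C₁ + C₀ / a) / m := by
    intro k hk
    rw [Set.uIoc_of_le hab.le] at hk
    have hθ := hphase k hk.1.le
    set θ := |x - 2 * k * t| with hθdef
    have hθ0 : 0 < θ := hm0.trans_le hθ
    have hnθ : ‖(x : ℂ) - 2 * k * t‖ = θ := by
      rw [hθdef, ← Real.norm_eq_abs, ← Complex.norm_real]
      push_cast; rfl
    have hg0 : |g k| ≤ C₀ := hC₀ k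
    have hg1 : |deriv g k| ≤ C₁ := hC₁ k
    have hat : 2 * a * |t| ≤ θ := by
      have := abs_nonneg x
      linarith
    rw [norm_mul, hvn, mul_one]
    calc ‖u' k‖ ≤ (C₁ * θ + C₀ * (2 * |t|)) / θ ^ 2 := by
          simp only [u', norm_div, norm_pow, norm_mul, Complex.norm_I, one_mul, hnθ]
          gcongr
          refine (norm_sub_le _ _).trans ?_
          simp only [norm_mul, norm_neg, Complex.norm_I, one_mul, hnθ, Complex.norm_real,
            Real.norm_eq_abs, Complex.norm_ofNat]
          gcongr
      _ ≤ (C₁ + C₀ / a) / θ := by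
          rw [div_le_div_iff₀ (by positivity) hθ0]
          have : C₀ * (2 * |t|) ≤ C₀ / a * θ := by
            rw [div_mul_eq_mul_div, le_div_iff₀ ha]
            nlinarith
          nlinarith [mul_le_mul_of_nonneg_right this hθ0.le]
      _ ≤ (C₁ + C₀ / a) / m := by gcongr
  refine (intervalIntegral.norm_integral_le_of_norm_le_const hbound).trans_eq ?_
  rw [abs_of_pos (sub_pos.2 hab)]
  ring

lemma topologicalClosure_eq_top_of_testFunctions (K : Submodule ℂ Hp)
    (hK : ∀ g : ℝ → ℝ, ContDiff ℝ 1 g → HasCompactSupport g → tsupport g ⊆ Set.Ioi 0 →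
      ∀ φ : Hp, φ =ᵐ[μp] (fun k => (g k : ℂ)) → φ ∈ K) :
    K.topologicalClosure = ⊤ := by
  rw [Submodule.topologicalClosure_eq_top_iff, Submodule.eq_bot_iff]
  intro f hf
  have hloc : LocallyIntegrableOn (f : ℝ → ℂ) (Set.Ioi 0) μp :=
    ((Lp.memLp f).locallyIntegrable (by norm_num)).locallyIntegrableOn _
  have h := isOpen_Ioi.ae_eq_zero_of_integral_contDiff_smul_eq_zero hloc fun g hg hc h0 => by
    have hmem : MemLp (fun k => (g k : ℂ)) 2 μp :=
      (Complex.continuous_ofReal.comp hg.continuous).memLp_of_hasCompactSupport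
        (hc.comp_left Complex.ofReal_zero)
    have horth := hf _ (hK g (hg.of_le (by exact_mod_cast le_top)) hc h0 hmem.toLp hmem.coeFn_toLp)
    rw [L2.inner_def] at horth
    rw [← horth]
    refine integral_congr_ae ?_
    filter_upwards [hmem.coeFn_toLp] with k hk
    rw [hk]
    simp [mul_comm]
  rw [Lp.eq_zero_iff_ae_eq_zero]
  filter_upwards [h, ae_restrict_mem measurableSet_Ioi] with k hk hk0 using hk hk0

lemma dense_integrable : Dense {φ : Hp | Integrable (φ : ℝ → ℂ) μp} := by
  let K : Submodule ℂ Hp :=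
    { carrier := {φ : Hp | Integrable (φ : ℝ → ℂ) μp}
      zero_mem' := (integrable_zero _ _ _).congr (Lp.coeFn_zero ℂ 2 μp).symm
      add_mem' := fun {φ χ} hφ hχ => (Integrable.add hφ hχ).congr (Lp.coeFn_add φ χ).symm
      smul_mem' := fun c φ hφ => (Integrable.smul c hφ).congr (Lp.coeFn_smul c φ).symm }
  have h := topologicalClosure_eq_top_of_testFunctions K fun g hg hc _ φ hφ =>
    (((Complex.continuous_ofReal.comp hg.continuous).integrable_of_hasCompactSupport
      (hc.comp_left Complex.ofReal_zero)).restrict).congr hφ.symm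
  exact Submodule.dense_iff_topologicalClosure_eq_top.2 h

instance : Nontrivial Hp := by
  refine ⟨indicatorConstLp 2 (measurableSet_Ioc (a := (0 : ℝ)) (b := 1)) (μ := μp)
    (by simp [Measure.restrict_apply]) (1 : ℂ), 0, fun h => ?_⟩
  have := congrArg norm h
  rw [norm_indicatorConstLp (by norm_num) (by norm_num)] at this
  have h1 : Set.Ioc (0 : ℝ) 1 ∩ Set.Ioi 0 = Set.Ioc 0 1 :=
    Set.inter_eq_left.2 fun x hx => hx.1
  simp [measureReal_def, Measure.restrict_apply measurableSet_Ioc, h1] at this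

section

variable {S : ℝ → Hp →L[ℂ] Hp} {R : Hp →L[ℂ] HL} {Pm : HL →L[ℂ] HL}

namespace Setup

lemma norm_S_ae (h : Setup S R Pm) (t : ℝ) (φ : Hp) : ∀ᵐ k ∂μp, ‖S t φ k‖ = ‖φ k‖ := by
  filter_upwards [h.hS t φ] with k hk
  have : -Complex.I * (k : ℂ) ^ 2 * (t : ℂ) = ((-(k ^ 2 * t) : ℝ) : ℂ) * Complex.I := by
    push_cast; ring
  rw [hk, norm_mul, this, Complex.norm_exp_ofReal_mul_I, one_mul]

lemma norm_S (h : Setup S R Pm) (t : ℝ) (φ : Hp) : ‖S t φ‖ = ‖φ‖ := by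
  rw [Lp.norm_def, Lp.norm_def, eLpNorm_congr_norm_ae (h.norm_S_ae t φ)]

lemma integrable_S (h : Setup S R Pm) (t : ℝ) {φ : Hp} (hφ : Integrable (φ : ℝ → ℂ) μp) :
    Integrable (S t φ : ℝ → ℂ) μp :=
  hφ.congr' (Lp.aestronglyMeasurable _) ((h.norm_S_ae t φ).mono fun _ hk => hk.symm)

lemma S_comp (h : Setup S R Pm) (s t : ℝ) (φ : Hp) : S s (S t φ) = S (s + t) φ := by
  refine Lp.ext ?_
  filter_upwards [h.hS s (S t φ), h.hS t φ, h.hS (s + t) φ] with k h1 h2 h3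
  rw [h1, h2, h3, ← mul_assoc, ← Complex.exp_add]
  push_cast
  ring_nf

lemma S_zero (h : Setup S R Pm) (φ : Hp) : S 0 φ = φ := by
  refine Lp.ext ?_
  filter_upwards [h.hS 0 φ] with k h1
  simp [h1]

lemma R_S_ae (h : Setup S R Pm) (t : ℝ) {φ : Hp} {f : ℝ → ℂ}
    (hφ : Integrable (φ : ℝ → ℂ) μp) (hf : φ =ᵐ[μp] f) :
    (R (S t φ) : ℝ → ℂ) =ᵐ[volume]
      fun x => (((2 * Real.pi) ^ (-(1/2) : ℝ) : ℝ) : ℂ) * waveInt f t x := by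
  filter_upwards [h.hR _ (h.integrable_S t hφ)] with x hx
  rw [hx, waveInt]
  congr 1
  refine integral_congr_ae ?_
  filter_upwards [h.hS t φ, hf] with k h1 h2
  rw [h1, h2]

lemma norm_Pm_sq (h : Setup S R Pm) (ψ : HL) :
    ‖Pm ψ‖ ^ 2 = ∫ x in Set.Iio (0 : ℝ), ‖ψ x‖ ^ 2 := by
  rw [norm_sq_eq_integral, ← integral_indicator measurableSet_Iio]
  refine integral_congr_ae ?_
  filter_upwards [h.hPm ψ] with x hx
  rw [hx]
  by_cases hx0 : x ∈ Set.Iio (0 : ℝ) <;> simp [hx0]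

lemma inner_Pm_self (h : Setup S R Pm) (ψ : HL) : inner ℂ (Pm ψ) ψ = ((‖Pm ψ‖ ^ 2 : ℝ) : ℂ) := by
  rw [L2.inner_def, norm_sq_eq_integral, ← integral_complex_ofReal]
  refine integral_congr_ae ?_
  filter_upwards [h.hPm ψ] with x hx
  rw [hx]
  by_cases hx0 : x ∈ Set.Iio (0 : ℝ) <;>
    simp [hx0]

lemma norm_sub_Pm_sq (h : Setup S R Pm) (ψ : HL) : ‖ψ - Pm ψ‖ ^ 2 = ‖ψ‖ ^ 2 - ‖Pm ψ‖ ^ 2 := by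
  have h1 := norm_sub_sq (𝕜 := ℂ) (Pm ψ) ψ
  rw [h.inner_Pm_self, norm_sub_rev] at h1
  simp only [RCLike.re_to_complex, Complex.ofReal_re] at h1
  linarith

lemma norm_Pm_le (h : Setup S R Pm) (ψ : HL) : ‖Pm ψ‖ ≤ ‖ψ‖ := by
  have := h.norm_sub_Pm_sq ψ
  exact le_of_sq_le_sq (by nlinarith [sq_nonneg ‖ψ - Pm ψ‖]) (norm_nonneg _)

lemma isPositive_Pm (h : Setup S R Pm) : Pm.IsPositive := by
  rw [ContinuousLinearMap.isPositive_iff_complex]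
  intro ψ
  rw [h.inner_Pm_self]
  exact ⟨rfl, sq_nonneg _⟩

lemma isSelfAdjoint_B1 (h : Setup S R Pm) (t₁ t₂ : ℝ) : IsSelfAdjoint (B1 S R Pm t₁ t₂) := by
  have key : ∀ t, IsSelfAdjoint ((ContinuousLinearMap.adjoint (S t)).comp
      ((ContinuousLinearMap.adjoint R).comp (Pm.comp (R.comp (S t))))) := fun t =>
    ((h.isPositive_Pm.adjoint_conj R).adjoint_conj (S t)).isSelfAdjoint
  exact (key t₂).sub (key t₁)

lemma isSelfAdjoint_BM (h : Setup S R Pm) (M : ℕ) (t : Fin (2 * M) → ℝ) :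
    IsSelfAdjoint (BM S R Pm M t) :=
  isSelfAdjoint_sum _ fun _ _ => h.isSelfAdjoint_B1 _ _

lemma re_inner_B1 (h : Setup S R Pm) (t₁ t₂ : ℝ) (φ : Hp) :
    (inner ℂ (B1 S R Pm t₁ t₂ φ) φ).re = ‖Pm (R (S t₂ φ))‖ ^ 2 - ‖Pm (R (S t₁ φ))‖ ^ 2 := by
  simp only [B1, sub_apply, ContinuousLinearMap.comp_apply, inner_sub_left,
    ContinuousLinearMap.adjoint_inner_left, h.inner_Pm_self, Complex.sub_re, Complex.ofReal_re]

lemma re_inner_BM_two (h : Setup S R Pm) (t : Fin (2 * 2) → ℝ) (φ : Hp) :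
    (inner ℂ (BM S R Pm 2 t φ) φ).re =
      ‖Pm (R (S (t 1) φ))‖ ^ 2 - ‖Pm (R (S (t 0) φ))‖ ^ 2 +
      (‖Pm (R (S (t 3) φ))‖ ^ 2 - ‖Pm (R (S (t 2) φ))‖ ^ 2) := by
  simp only [BM, Fin.sum_univ_two, add_apply, inner_add_left, Complex.add_re, h.re_inner_B1]
  rfl

lemma exists_dilate (h : Setup S R Pm) {l : ℝ} (hl : 0 < l) {φ : Hp}
    (hφ : Integrable (φ : ℝ → ℂ) μp) :
    ∃ χ : Hp, ‖χ‖ = ‖φ‖ ∧ ∀ t, ‖Pm (R (S t χ))‖ = ‖Pm (R (S (t / l ^ 2) φ))‖ := by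
  set f : ℝ → ℂ := fun k => (√l : ℂ) * φ (l * k) with hf
  have hsq : ∀ k, ‖f k‖ ^ 2 = l * ‖φ (l * k)‖ ^ 2 := fun k => by
    simp [hf, mul_pow, Real.sq_sqrt hl.le, abs_of_nonneg (Real.sqrt_nonneg l)]
  have hmeas : AEStronglyMeasurable f μp :=
    (((Lp.stronglyMeasurable φ).comp_measurable (measurable_const_mul l)).const_mul
      _).aestronglyMeasurable
  have hint : Integrable f μp := by
    have := (integrableOn_Ioi_comp_mul_left_iff (φ : ℝ → ℂ) 0 hl).2 (by rw [mul_zero]; exact hφ)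
    exact Integrable.const_mul this _
  have hmem : MemLp f 2 μp := by
    rw [memLp_two_iff_integrable_sq_norm hmeas]
    simp only [hsq]
    have h2 := (memLp_two_iff_integrable_sq_norm (Lp.aestronglyMeasurable φ)).1 (Lp.memLp φ)
    have := (integrableOn_Ioi_comp_mul_left_iff (fun k => ‖φ k‖ ^ 2) 0 hl).2 (by rw [mul_zero]; exact h2)
    exact Integrable.const_mul this _
  have hae := hmem.coeFn_toLp
  refine ⟨hmem.toLp, ?_, fun t => ?_⟩ <;>
    rw [← sq_eq_sq₀ (norm_nonneg _) (norm_nonneg _)]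
  · rw [norm_sq_eq_integral, norm_sq_eq_integral]
    have h1 := integral_comp_mul_left_Ioi (fun k => ‖φ k‖ ^ 2) 0 hl
    rw [mul_zero, smul_eq_mul] at h1
    calc _ = ∫ k, l * ‖φ (l * k)‖ ^ 2 ∂μp := by
          refine integral_congr_ae ?_
          filter_upwards [hae] with k hk
          rw [hk, hsq]
      _ = _ := by
          rw [integral_const_mul, h1, mul_inv_cancel_left₀ hl.ne']
  · rw [h.norm_Pm_sq, h.norm_Pm_sq, ← integral_indicator measurableSet_Iio,
      ← integral_indicator measurableSet_Iio]
    set c : ℂ := (((2 * Real.pi) ^ (-(1/2) : ℝ) : ℝ) : ℂ)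
    set F : ℝ → ℝ := (Set.Iio (0 : ℝ)).indicator fun x => ‖c * waveInt φ (t / l ^ 2) x‖ ^ 2
    have h1 := Measure.integral_comp_div F l
    rw [abs_of_pos hl, smul_eq_mul] at h1
    calc _ = ∫ x, l⁻¹ * F (x / l) := by
          refine integral_congr_ae ?_
          filter_upwards [h.R_S_ae t (hint.congr hae.symm) hae] with x hx
          have hxl : x / l < 0 ↔ x < 0 := by rw [div_lt_iff₀ hl, zero_mul]
          by_cases hx0 : x < 0
          · simp only [F, Set.indicator, Set.mem_Iio, hxl, hx0, if_true]
            rw [hx, hf, waveInt_dilate _ hl]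
            simp only [norm_mul, mul_pow, norm_inv, Complex.norm_real, Real.norm_eq_abs,
              sq_abs, Real.sq_sqrt hl.le, inv_pow]
            simp only [c, Complex.norm_real, Real.norm_eq_abs, sq_abs]
            field_simp
          · simp [F, hxl, hx0]
      _ = ∫ x, F x := by rw [integral_const_mul, h1, inv_mul_cancel_left₀ hl.ne']
      _ = _ := by
          refine integral_congr_ae ?_
          filter_upwards [h.R_S_ae (t / l ^ 2) hφ (ae_eq_refl _)] with x hx
          simp only [F, Set.indicator, hx]
          rfl

lemma sub_le_cBM (h : Setup S R Pm) {t₁ t₂ : ℝ} (ht : t₁ < t₂) (φ : Hp) :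
    ‖Pm (R (S t₂ φ))‖ ^ 2 - ‖Pm (R (S t₁ φ))‖ ^ 2 ≤ cBM S R Pm * ‖φ‖ ^ 2 := by
  have h01 := (sSup_spectrum_le_iff (h.isSelfAdjoint_B1 0 1) (cBM S R Pm)).1 le_rfl
  simp only [h.re_inner_B1] at h01
  have hτ : 0 < t₂ - t₁ := sub_pos.2 ht
  have key : ∀ ψ : Hp, ‖Pm (R (S (t₂ - t₁) ψ))‖ ^ 2 - ‖Pm (R (S 0 ψ))‖ ^ 2 ≤
      cBM S R Pm * ‖ψ‖ ^ 2 := by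
    have hcl : IsClosed {ψ : Hp | ‖Pm (R (S (t₂ - t₁) ψ))‖ ^ 2 - ‖Pm (R (S 0 ψ))‖ ^ 2 ≤
        cBM S R Pm * ‖ψ‖ ^ 2} := isClosed_le (by fun_prop) (by fun_prop)
    intro ψ
    refine hcl.closure_subset_iff.2 (fun ψ hψ => ?_) (dense_integrable ψ)
    obtain ⟨χ, hχ, hχt⟩ := h.exists_dilate (l := (√(t₂ - t₁))⁻¹) (by positivity) hψ
    have := h01 χ
    rw [hχ, hχt, hχt, inv_pow, Real.sq_sqrt hτ.le] at this
    simpa using this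
  have := key (S t₁ φ)
  rwa [h.S_comp, h.S_comp, sub_add_cancel, zero_add, h.norm_S] at this

lemma tendsto_zero_of_indicator (h : Setup S R Pm) {E : HL →L[ℂ] HL} {A : Set ℝ}
    (hE : ∀ ψ : HL, (E ψ : ℝ → ℂ) =ᵐ[volume] A.indicator (fun x => ψ x))
    (hEn : ∀ ψ : HL, ‖E ψ‖ ≤ ‖ψ‖) {l : Filter ℝ} [l.IsCountablyGenerated]
    (hA : ∀ᶠ t in l, ∀ x ∈ A, x * t ≤ 0) (hl : Tendsto (fun t : ℝ => |t|) l atTop) (φ : Hp) :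
    Tendsto (fun t => E (R (S t φ))) l (nhds 0) := by
  let K : Submodule ℂ Hp :=
    { carrier := {φ : Hp | Tendsto (fun t => E (R (S t φ))) l (nhds 0)}
      zero_mem' := by simpa using tendsto_const_nhds
      add_mem' := fun {φ χ} hφ hχ => by
        simpa using Tendsto.add (Set.mem_ofPred.1 hφ) (Set.mem_ofPred.1 hχ)
      smul_mem' := fun c φ hφ => by
        simpa using Tendsto.const_smul (Set.mem_ofPred.1 hφ) c }
  have hn : ∀ t (φ : Hp), ‖E (R (S t φ))‖ ≤ ‖φ‖ := fun t φ =>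
    (hEn _).trans_eq ((h.hR_isometry _).trans (h.norm_S t φ))
  have hclosed : K.topologicalClosure = ⊤ := by
    refine topologicalClosure_eq_top_of_testFunctions K fun g hg hc h0 φ hφ => ?_
    change Tendsto (fun t => E (R (S t φ))) l (nhds 0)
    obtain ⟨a, C, ha, hC, hw⟩ := norm_waveInt_le hg hc h0
    set c : ℝ := (2 * Real.pi) ^ (-(1/2) : ℝ)
    have hint : Integrable (φ : ℝ → ℂ) μp :=
      (((Complex.continuous_ofReal.comp hg.continuous).integrable_of_hasCompactSupport
        (hc.comp_left Complex.ofReal_zero)).restrict).congr hφ.symm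
    have hbd : ∀ᶠ t in l, ∀ᵐ x, ‖E (R (S t φ)) x‖ ≤ |c| * (C / (|x| + 2 * a * |t|)) := by
      filter_upwards [hA, hl.eventually_gt_atTop 0] with t htA ht
      filter_upwards [hE (R (S t φ)), h.R_S_ae t hint hφ] with x h1 h2
      rw [h1]
      by_cases hx : x ∈ A
      · rw [Set.indicator_of_mem hx, h2, norm_mul, Complex.norm_real, Real.norm_eq_abs]
        gcongr
        exact hw x t (htA x hx) (abs_pos.1 ht)
      · rw [Set.indicator_of_notMem hx, norm_zero]
        positivity
    let G : ℝ → ℝ → ℝ := fun t x => (|c| * (C / (|x| + 2 * a * |t|))) ^ 2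
    have hden : ∀ x : ℝ, Tendsto (fun t : ℝ => |x| + 2 * a * |t|) l atTop := fun x =>
      tendsto_atTop_add_const_left _ _ (hl.const_mul_atTop (by positivity))
    have hGmeas : ∀ t, AEStronglyMeasurable (G t) volume := fun t =>
      (by fun_prop : Measurable (G t)).aestronglyMeasurable
    have hGint : Integrable (fun x : ℝ => (|c| * C) ^ 2 * (1 + x ^ 2)⁻¹) :=
      integrable_inv_one_add_sq.const_mul _
    have hGle : ∀ᶠ t in l, ∀ᵐ x, ‖G t x‖ ≤ (|c| * C) ^ 2 * (1 + x ^ 2)⁻¹ := by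
      filter_upwards [(hden 0).eventually_ge_atTop 1] with t ht
      rw [abs_zero, zero_add] at ht
      refine .of_forall fun x => ?_
      rw [Real.norm_of_nonneg (sq_nonneg _), ← mul_div_assoc, div_pow, div_eq_mul_inv]
      gcongr
      nlinarith [abs_nonneg x, sq_abs x]
    have hlim : Tendsto (fun t => ∫ x, G t x) l (nhds (∫ _ : ℝ, 0)) :=
      tendsto_integral_filter_of_dominated_convergence _ (.of_forall hGmeas) hGle hGint
        (.of_forall fun x => by
          simpa using (((hden x).const_div_atTop C).const_mul |c|).pow 2)
    rw [integral_zero] at hlim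
    have hsq : Tendsto (fun t => ‖E (R (S t φ))‖ ^ 2) l (nhds 0) := by
      refine squeeze_zero' (.of_forall fun _ => sq_nonneg _) ?_ hlim
      filter_upwards [hbd, hGle] with t ht hGt
      rw [norm_sq_eq_integral]
      refine integral_mono_of_nonneg (.of_forall fun _ => sq_nonneg _)
        (hGint.mono' (hGmeas t) hGt) ?_
      filter_upwards [ht] with x hx using pow_le_pow_left₀ (norm_nonneg _) hx 2
    rw [tendsto_zero_iff_norm_tendsto_zero]
    simpa [Real.sqrt_sq] using hsq.sqrt
  rw [Metric.tendsto_nhds]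
  intro ε hε
  have hmem : φ ∈ closure (K : Set Hp) := by
    rw [← Submodule.topologicalClosure_coe, hclosed]; trivial
  obtain ⟨χ, hχ, hdist⟩ := Metric.mem_closure_iff.1 hmem (ε / 2) (half_pos hε)
  filter_upwards [Metric.tendsto_nhds.1 (Set.mem_ofPred.1 hχ) (ε / 2) (half_pos hε)] with t ht
  rw [dist_zero_right] at ht ⊢
  have h1 := hn t (φ - χ)
  rw [dist_eq_norm] at hdist
  calc ‖E (R (S t φ))‖ = ‖E (R (S t (φ - χ))) + E (R (S t χ))‖ := by simp
    _ ≤ ‖E (R (S t (φ - χ)))‖ + ‖E (R (S t χ))‖ := norm_add_le _ _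
    _ < ε := by linarith

lemma tendsto_norm_atTop (h : Setup S R Pm) (φ : Hp) :
    Tendsto (fun t => ‖Pm (R (S t φ))‖ ^ 2) atTop (nhds 0) := by
  have := h.tendsto_zero_of_indicator h.hPm h.norm_Pm_le (l := atTop)
    ((eventually_ge_atTop 0).mono fun t ht x hx => mul_nonpos_of_nonpos_of_nonneg (le_of_lt hx) ht)
    tendsto_abs_atTop_atTop φ
  simpa using this.norm.pow 2

lemma tendsto_norm_atBot (h : Setup S R Pm) (φ : Hp) :
    Tendsto (fun t => ‖Pm (R (S t φ))‖ ^ 2) atBot (nhds (‖φ‖ ^ 2)) := by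
  have hE : ∀ ψ : HL, ((ContinuousLinearMap.id ℂ HL - Pm) ψ : ℝ → ℂ) =ᵐ[volume]
      (Set.Iio (0 : ℝ))ᶜ.indicator (fun x => ψ x) := fun ψ => by
    filter_upwards [Lp.coeFn_sub ψ (Pm ψ), h.hPm ψ] with x h1 h2
    change (ψ - Pm ψ : HL) x = _
    rw [h1, Pi.sub_apply, h2, Set.indicator_compl]
    rfl
  have hEn : ∀ ψ : HL, ‖(ContinuousLinearMap.id ℂ HL - Pm) ψ‖ ≤ ‖ψ‖ := fun ψ =>
    le_of_sq_le_sq ((h.norm_sub_Pm_sq ψ).trans_le (by simp)) (norm_nonneg _)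
  have := h.tendsto_zero_of_indicator hE hEn (l := atBot)
    ((eventually_le_atBot 0).mono fun t ht x hx =>
      mul_nonpos_of_nonneg_of_nonpos (not_lt.1 hx) ht)
    tendsto_abs_atBot_atTop φ
  have h2 := (this.norm.pow 2).const_sub (‖φ‖ ^ 2)
  simp only [sub_apply, ContinuousLinearMap.id_apply, h.norm_sub_Pm_sq, h.hR_isometry,
    h.norm_S, sub_sub_cancel] at h2
  simpa using h2

lemma norm_Pm_R_S_sq_le (h : Setup S R Pm) (t : ℝ) (φ : Hp) :
    ‖Pm (R (S t φ))‖ ^ 2 ≤ ‖φ‖ ^ 2 := by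
  have := h.norm_Pm_le (R (S t φ))
  rw [h.hR_isometry, h.norm_S] at this
  gcongr

lemma le_sInf_spectrum_BM (h : Setup S R Pm) {t : Fin (2 * 2) → ℝ} (ht : StrictMono t) :
    -1 - cBM S R Pm ≤ sInf (spectrum ℝ (BM S R Pm 2 t)) := by
  refine (le_sInf_spectrum_iff (h.isSelfAdjoint_BM 2 t) _).2 fun φ => ?_
  rw [h.re_inner_BM_two]
  have h1 := h.sub_le_cBM (ht (by decide : (1 : Fin (2 * 2)) < 2)) φ
  have h2 := h.norm_Pm_R_S_sq_le (t 0) φ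
  have h3 := sq_nonneg ‖Pm (R (S (t 3) φ))‖
  linarith

lemma cover2_mul_le (h : Setup S R Pm) (φ : Hp) :
    cover2 S R Pm * ‖φ‖ ^ 2 ≤
      ‖Pm (R (S 0 φ))‖ ^ 2 - ‖φ‖ ^ 2 - ‖Pm (R (S 1 φ))‖ ^ 2 := by
  have hle : ∀ n : ℝ, 1 < n → cover2 S R Pm * ‖φ‖ ^ 2 ≤
      ‖Pm (R (S 0 φ))‖ ^ 2 - ‖Pm (R (S (-n) φ))‖ ^ 2 +
        (‖Pm (R (S n φ))‖ ^ 2 - ‖Pm (R (S 1 φ))‖ ^ 2) := by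
    intro n hn
    let t : Fin (2 * 2) → ℝ := ![-n, 0, 1, n]
    have ht : StrictMono t := by
      rw [Fin.strictMono_iff_lt_succ]
      intro i
      fin_cases i <;> simp [t] <;> linarith
    have hbdd : BddBelow ((fun t => sInf (spectrum ℝ (BM S R Pm 2 t))) '' TM 2) :=
      ⟨-1 - cBM S R Pm, by rintro _ ⟨s, hs, rfl⟩; exact h.le_sInf_spectrum_BM hs⟩
    have h1 := (le_sInf_spectrum_iff (h.isSelfAdjoint_BM 2 t) _).1
      (csInf_le hbdd ⟨t, ht, rfl⟩) φ
    rwa [h.re_inner_BM_two] at h1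
  have hlim := ((h.tendsto_norm_atBot φ).comp tendsto_neg_atTop_atBot).const_sub
    (‖Pm (R (S 0 φ))‖ ^ 2) |>.add ((h.tendsto_norm_atTop φ).sub_const (‖Pm (R (S 1 φ))‖ ^ 2))
  refine (ge_of_tendsto hlim ((eventually_gt_atTop 1).mono hle)).trans_eq ?_
  ring

end Setup

end

/-- the second overflow constant satisfies `c_over^{(2)} = −1 − c_BM`. -/
theorem second_overflow_constant
    (S : ℝ → Hp →L[ℂ] Hp) (R : Hp →L[ℂ] HL) (Pm : HL →L[ℂ] HL)
    (hSetup : Setup S R Pm) :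
    cover2 S R Pm = -1 - cBM S R Pm := by
  refine le_antisymm ?_ ?_
  · have : cBM S R Pm ≤ -1 - cover2 S R Pm := (sSup_spectrum_le_iff (hSetup.isSelfAdjoint_B1 0 1) (-1 - cover2 S R Pm)).2
      fun φ => by
        rw [hSetup.re_inner_B1]
        linarith [hSetup.cover2_mul_le φ]
    linarith
  · refine le_csInf (Set.Nonempty.image _ ⟨fun i => ((i : ℕ) : ℝ), fun i j hij => ?_⟩) ?_
    · simpa using hij
    · rintro _ ⟨t, ht, rfl⟩
      exact hSetup.le_sInf_spectrum_BM ht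

end QB
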